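/- arXiv:2310.12511 — 3 statements merged into one kernel-verified Lean document; each statement's English description precedes it below -/
import Mathlib

section
/- Let G be a k×n matrix over F_q of rank k, let ℓ ≥ 1 be an integer, and let K be a field with q^ℓ elements containing F_q as a subfield. For every integer i with 1 ≤ i ≤ n, the number of codewords of Hamming weight i in the lifted code {xG : x ∈ K^k} ⊆ K^n equals ∑_{j=1}^{k} A_i^{(j)} · (q^ℓ − 1)(q^ℓ − q)⋯(q^ℓ − q^{j−1}), where A_i^{(j)} is the number of (k−j)-dimensional F_q-subspaces U of F_q^k such that exactly n − i of the n columns of G (counted with multiplicity) belong to U. -/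
open Matrix Module

theorem card_injective_linearMap {F V W : Type*} [Field F] [Fintype F]
    [AddCommGroup V] [Module F V] [FiniteDimensional F V]
    [AddCommGroup W] [Module F W] [Finite W] :
    Nat.card {f : V →ₗ[F] W // Function.Injective f} =
      ∏ s ∈ Finset.range (finrank F V), (Nat.card W - Fintype.card F ^ s) := by
  have hW : Nat.card W = Fintype.card F ^ finrank F W := by
    rw [Module.natCard_eq_pow_finrank (K := F), Nat.card_eq_fintype_card]
  by_cases h : finrank F V ≤ finrank F W
  · rw [hW, Finset.prod_range, ← card_linearIndependent h]
    refine Nat.card_congr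
      (((finBasis F V).constr F).symm.toEquiv.subtypeEquiv fun f ↦ ?_)
    have hf : (((finBasis F V).constr F).symm f : Fin (finrank F V) → W) = f ∘ finBasis F V := rfl
    change _ ↔ LinearIndependent F (((finBasis F V).constr F).symm f)
    rw [hf]
    exact ⟨fun h ↦ (finBasis F V).linearIndependent.map' f (LinearMap.ker_eq_bot.2 h),
      LinearMap.injective_of_linearIndependent (finBasis F V).span_eq⟩
  · have : IsEmpty {f : V →ₗ[F] W // Function.Injective f} :=
      ⟨fun f ↦ h (LinearMap.finrank_le_finrank_of_injective f.2)⟩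
    rw [Nat.card_of_isEmpty, eq_comm]
    exact Finset.prod_eq_zero (Finset.mem_range.2 (not_le.1 h)) (by rw [hW, Nat.sub_self])

theorem card_linearMap_ker_eq {F V W : Type*} [Field F] [Fintype F]
    [AddCommGroup V] [Module F V] [FiniteDimensional F V]
    [AddCommGroup W] [Module F W] [Finite W] (U : Submodule F V) :
    Nat.card {f : V →ₗ[F] W // LinearMap.ker f = U} =
      ∏ s ∈ Finset.range (finrank F V - finrank F U), (Nat.card W - Fintype.card F ^ s) := by
  rw [← Submodule.finrank_quotient, ← card_injective_linearMap]
  refine Nat.card_congr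
    { toFun f := ⟨U.liftQ f.1 f.2.ge,
        LinearMap.ker_eq_bot.1 (U.ker_liftQ_eq_bot _ _ f.2.le)⟩
      invFun g := ⟨g.1 ∘ₗ U.mkQ, by
        rw [LinearMap.ker_comp, LinearMap.ker_eq_bot.2 g.2, Submodule.comap_bot, U.ker_mkQ]⟩
      left_inv f := by ext; simp
      right_inv g := by ext; simp }

theorem card_linearMap_ker_pred {F V W : Type*} [Field F] [Fintype F]
    [AddCommGroup V] [Module F V] [FiniteDimensional F V]
    [AddCommGroup W] [Module F W] [Finite W] (P : Submodule F V → Prop) (htop : ¬ P ⊤) :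
    Nat.card {f : V →ₗ[F] W // P (LinearMap.ker f)} =
      ∑ j ∈ Finset.Icc 1 (finrank F V),
        Nat.card {U : Submodule F V // finrank F U = finrank F V - j ∧ P U} *
          ∏ s ∈ Finset.range j, (Nat.card W - Fintype.card F ^ s) := by
  classical
  have : Finite V := Module.finite_of_finite F
  have : Finite (V →ₗ[F] W) := Finite.of_injective _ DFunLike.coe_injective
  have : Fintype (V →ₗ[F] W) := Fintype.ofFinite _
  have : Fintype (Submodule F V) := Fintype.ofFinite _
  simp only [Nat.card_eq_fintype_card, Fintype.card_subtype]
  rw [Finset.card_eq_sum_card_fiberwise (t := Finset.univ.filter P)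
    (f := fun f : V →ₗ[F] W ↦ LinearMap.ker f) (by intro; simp),
    ← Finset.sum_fiberwise_of_maps_to (t := Finset.Icc 1 (finrank F V))
      (g := fun U : Submodule F V ↦ finrank F V - finrank F U)]
  · refine Finset.sum_congr rfl fun j hj ↦ ?_
    rw [Finset.mem_Icc] at hj
    rw [Finset.filter_filter]
    have hfil : Finset.univ.filter (fun U : Submodule F V ↦
        P U ∧ finrank F V - finrank F U = j) =
        Finset.univ.filter (fun U : Submodule F V ↦ finrank F U = finrank F V - j ∧ P U) := by
      ext U
      have := U.finrank_le
      simp only [Finset.mem_filter, Finset.mem_univ, true_and]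
      rw [and_comm]
      refine and_congr_left fun _ ↦ ?_
      omega
    rw [hfil]
    refine Finset.sum_const_nat fun U hU ↦ ?_
    simp only [Finset.mem_filter, Finset.mem_univ, true_and] at hU
    have hker := card_linearMap_ker_eq (W := W) U
    rw [Nat.card_eq_fintype_card, Fintype.card_subtype, hU.1, Nat.sub_sub_self hj.2] at hker
    rw [← hker, Finset.filter_filter]
    congr 1
    ext f
    simp only [Finset.mem_filter, Finset.mem_univ, true_and]
    exact ⟨And.right, fun h ↦ ⟨h ▸ hU.2, h⟩⟩
  · intro U hU
    rw [Finset.mem_filter] at hU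
    have : finrank F U < finrank F V :=
      Submodule.finrank_lt (fun h ↦ htop (h ▸ hU.2))
    rw [Finset.mem_Icc]
    omega

theorem vecMul_map_algebraMap_apply {F K : Type*} [Field F] [Field K] [Algebra F K] {k n : ℕ}
    (G : Matrix (Fin k) (Fin n) F) (x : Fin k → K) (c : Fin n) :
    Matrix.vecMul x (G.map (algebraMap F K)) c =
      (Pi.basisFun F (Fin k)).constr F x (G.col c) := by
  simp [Basis.constr_apply_fintype, Matrix.vecMul, dotProduct, Algebra.smul_def, mul_comm]

theorem eq_of_eqOn_cols {F W : Type*} [Field F] [AddCommGroup W] [Module F W] {k n : ℕ}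
    {G : Matrix (Fin k) (Fin n) F} (hG : G.rank = k) {f g : (Fin k → F) →ₗ[F] W}
    (h : ∀ c, f (G.col c) = g (G.col c)) : f = g := by
  refine LinearMap.ext_on_range (v := G.col) (Submodule.eq_top_of_finrank_eq ?_) h
  rw [← Matrix.rank_eq_finrank_span_cols, hG, finrank_fin_fun]

theorem hammingNorm_eq_iff_card_zero {n : ℕ} {K : Type*} [Zero K] [DecidableEq K]
    {i : ℕ} (hin : i ≤ n) (c : Fin n → K) :
    hammingNorm c = i ↔ Nat.card {a : Fin n // c a = 0} = n - i := by
  have h := Finset.card_filter_add_card_filter_not (s := Finset.univ) (fun a ↦ c a = 0)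
  rw [Nat.card_eq_fintype_card, Fintype.card_subtype, hammingNorm]
  simp only [Finset.card_univ, Fintype.card_fin] at h
  simp only [ne_eq]
  omega

/-- The number of codewords of Hamming weight `i` in the lifted code over `K`
of the code generated by `G` equals `∑_{j=1}^{k} A_i^{(j)} (q^ℓ-1)⋯(q^ℓ-q^{j-1})`,
where `A_i^{(j)}` counts `(k-j)`-dimensional subspaces of `F^k` containing exactly
`n - i` of the columns of `G` (with multiplicity). -/
theorem stmt_0 (q k n ℓ : ℕ) (hℓ : 1 ≤ ℓ)
    (F K : Type) [Field F] [Fintype F]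
    [Field K] [Fintype K] [DecidableEq K] [Algebra F K]
    (hF : Fintype.card F = q) (hK : Fintype.card K = q ^ ℓ)
    (G : Matrix (Fin k) (Fin n) F) (hG : G.rank = k)
    (i : ℕ) (hi1 : 1 ≤ i) (hin : i ≤ n) :
    Nat.card {c : Fin n → K //
        (∃ x : Fin k → K, Matrix.vecMul x (G.map (algebraMap F K)) = c) ∧ hammingNorm c = i} =
      ∑ j ∈ Finset.Icc 1 k,
        Nat.card {U : Submodule F (Fin k → F) //
            Module.finrank F U = k - j ∧
            Nat.card {c : Fin n // (fun r => G r c) ∈ U} = n - i} *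
          ∏ s ∈ Finset.range j, (q ^ ℓ - q ^ s) := by
  have htop : ¬ Nat.card {c : Fin n // (fun r => G r c) ∈ (⊤ : Submodule F (Fin k → F))} =
      n - i := by
    simp
    omega
  have key := card_linearMap_ker_pred (W := K) (fun U : Submodule F (Fin k → F) ↦
    Nat.card {c : Fin n // (fun r => G r c) ∈ U} = n - i) htop
  rw [finrank_fin_fun, Nat.card_eq_fintype_card (α := K), hK, hF] at key
  rw [← key]
  symm
  refine Nat.card_congr (Equiv.ofBijective
    (fun f ↦ ⟨fun c ↦ f.1 (G.col c),
      ⟨((Pi.basisFun F (Fin k)).constr F).symm f.1, funext fun c ↦ ?_⟩,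
      (hammingNorm_eq_iff_card_zero hin _).2 f.2⟩) ⟨fun f g hfg ↦ ?_, ?_⟩)
  · rw [vecMul_map_algebraMap_apply, LinearEquiv.apply_symm_apply]
  · exact Subtype.ext (eq_of_eqOn_cols hG (congrFun (congrArg Subtype.val hfg)))
  · rintro ⟨_, ⟨x, rfl⟩, hx⟩
    have hcol := vecMul_map_algebraMap_apply G x
    refine ⟨⟨(Pi.basisFun F (Fin k)).constr F x, ?_⟩, Subtype.ext (funext fun c ↦ (hcol c).symm)⟩
    rw [hammingNorm_eq_iff_card_zero hin] at hx
    simp only [hcol] at hx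
    exact hx
end

section
/- Let S_{u1} and S_{u2} be subspaces of F_q^k of dimensions u1 and u2 with S_{u1} ∩ S_{u2} = {0}. Let t1, t2, t be integers with 0 ≤ t1 ≤ u1, 0 ≤ t2 ≤ u2 and 0 ≤ t ≤ min(u1 − t1, u2 − t2). Then the number of (t + t1 + t2)-dimensional F_q-subspaces V of S_{u1} + S_{u2} with dim(V ∩ S_{u1}) = t1 and dim(V ∩ S_{u2}) = t2 equals (q^t − 1)(q^t − q)⋯(q^t − q^{t−1}) · [u1−t1, t]_q · [u2−t2, t]_q · [u1, t1]_q · [u2, t2]_q when t ≥ 1, and equals [u1, t1]_q · [u2, t2]_q when t = 0. -/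
open Matrix Module

/-- The Gaussian binomial coefficient `[n, m]_q`. -/
def gbinom (q : ℕ) (n m : ℤ) : ℕ :=
  if 0 ≤ m ∧ m ≤ n then
    (∏ i ∈ Finset.range m.toNat, (q ^ n.toNat - q ^ i)) /
      (∏ i ∈ Finset.range m.toNat, (q ^ m.toNat - q ^ i))
  else 0

theorem Nat.card_eq_card_mul_of_card_fiber {α β : Type*} [Finite α] [Finite β] (f : α → β)
    (c : ℕ) (h : ∀ b, Nat.card {a // f a = b} = c) : Nat.card α = Nat.card β * c := by
  have := Fintype.ofFinite β
  rw [← Nat.card_congr (Equiv.sigmaFiberEquiv f), Nat.card_sigma]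
  simp [h]

section Linear

variable {K V V' : Type*} [Field K] [AddCommGroup V] [Module K V] [AddCommGroup V'] [Module K V']

theorem span_range_coe_eq {m : ℕ} {U : Submodule K V} [FiniteDimensional K U]
    (hU : finrank K U = m) {s : Fin m → U} (hs : LinearIndependent K s) :
    Submodule.span K (Set.range fun i => (s i : V)) = U := by
  have hs' : LinearIndependent K fun i => (s i : V) := hs.map' U.subtype U.ker_subtype
  refine Submodule.eq_of_le_of_finrank_eq (Submodule.span_le.2 ?_) ?_
  · rintro _ ⟨i, rfl⟩
    exact (s i).2
  · rw [finrank_span_eq_card hs', hU, Fintype.card_fin]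

theorem linearIndependent_comp_iff {ι : Type*} (f : V →ₗ[K] V') (v : ι → V) :
    LinearIndependent K (f ∘ v) ↔
      LinearIndependent K v ∧ Disjoint (Submodule.span K (Set.range v)) (LinearMap.ker f) :=
  ⟨fun h => ⟨h.of_comp f, Submodule.range_ker_disjoint h⟩, fun h => h.1.map h.2⟩

theorem comap_inl_eq_bot_iff (U : Submodule K (V × V')) :
    U.comap (LinearMap.inl K V V') = ⊥ ↔ Disjoint U (LinearMap.ker (LinearMap.snd K V V')) := by
  rw [Submodule.disjoint_def, Submodule.eq_bot_iff]
  constructor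
  · rintro h ⟨a, b⟩ hU hb
    obtain rfl : b = 0 := hb
    rw [h a hU]
    rfl
  · intro h a ha
    exact congrArg Prod.fst (h _ ha rfl)

theorem comap_inr_eq_bot_iff (U : Submodule K (V × V')) :
    U.comap (LinearMap.inr K V V') = ⊥ ↔ Disjoint U (LinearMap.ker (LinearMap.fst K V V')) := by
  rw [Submodule.disjoint_def, Submodule.eq_bot_iff]
  constructor
  · rintro h ⟨a, b⟩ hU ha
    obtain rfl : a = 0 := ha
    rw [h b hU]
    rfl
  · intro h b hb
    exact congrArg Prod.snd (h _ hb rfl)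

theorem comap_mkQ_eq_self_iff {A : Submodule K V} (U : Submodule K (V ⧸ A)) :
    U.comap A.mkQ = A ↔ U = ⊥ := by
  rw [← (Submodule.comap_injective_of_surjective A.mkQ_surjective).eq_iff, Submodule.comap_bot,
    A.ker_mkQ]

theorem finrank_comap_of_surjective [FiniteDimensional K V] {f : V →ₗ[K] V'}
    (hf : Function.Surjective f) (p : Submodule K V') :
    finrank K (p.comap f) = finrank K p + finrank K (LinearMap.ker f) := by
  rw [← LinearMap.finrank_range_add_finrank_ker (f.domRestrict (p.comap f)),
    LinearMap.range_domRestrict, Submodule.map_comap_eq_of_surjective hf,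
    LinearMap.ker_domRestrict]
  congr 1
  exact (Submodule.comapSubtypeEquivOfLe (LinearMap.ker_le_comap f)).finrank_eq

theorem finrank_comap_of_injective {f : V →ₗ[K] V'} (hf : Function.Injective f)
    (p : Submodule K V') :
    finrank K (p.comap f) = finrank K ↥(p ⊓ LinearMap.range f) := by
  rw [inf_comm, ← Submodule.map_comap_eq]
  exact (Submodule.equivMapOfInjective f hf (p.comap f)).finrank_eq

theorem finrank_submodule_prod [FiniteDimensional K V] [FiniteDimensional K V']
    (A : Submodule K V) (B : Submodule K V') :
    finrank K (A.prod B) = finrank K A + finrank K B := by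
  have h : LinearMap.range (A.subtype.prodMap B.subtype) = A.prod B := by
    rw [LinearMap.range_prodMap, A.range_subtype, B.range_subtype]
  rw [← h, LinearMap.finrank_range_of_inj (A.injective_subtype.prodMap B.injective_subtype),
    finrank_prod]

/-- Subspaces of a product with prescribed intersections with the two factors correspond to
subspaces of the product of the quotients meeting both factors trivially. -/
theorem card_comap_eq {M₁ M₂ : Type*} [AddCommGroup M₁] [Module K M₁] [FiniteDimensional K M₁]
    [AddCommGroup M₂] [Module K M₂] [FiniteDimensional K M₂]
    (A₁ : Submodule K M₁) (A₂ : Submodule K M₂) (t : ℕ) :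
    Nat.card {V : Submodule K (M₁ × M₂) // finrank K V = t + finrank K A₁ + finrank K A₂ ∧
        V.comap (LinearMap.inl K M₁ M₂) = A₁ ∧ V.comap (LinearMap.inr K M₁ M₂) = A₂} =
      Nat.card {V : Submodule K ((M₁ ⧸ A₁) × (M₂ ⧸ A₂)) // finrank K V = t ∧
        V.comap (LinearMap.inl K _ _) = ⊥ ∧ V.comap (LinearMap.inr K _ _) = ⊥} := by
  set f := A₁.mkQ.prodMap A₂.mkQ with hf
  have hsurj : Function.Surjective f := A₁.mkQ_surjective.prodMap A₂.mkQ_surjective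
  have hker : LinearMap.ker f = A₁.prod A₂ := by simp [hf, LinearMap.ker_prodMap]
  have hdim (W) : finrank K (Submodule.comap f W) =
      finrank K W + finrank K A₁ + finrank K A₂ := by
    rw [finrank_comap_of_surjective hsurj, hker, finrank_submodule_prod, add_assoc]
  have hinl (W : Submodule K ((M₁ ⧸ A₁) × (M₂ ⧸ A₂))) :
      (W.comap f).comap (LinearMap.inl K M₁ M₂) = A₁ ↔ W.comap (LinearMap.inl K _ _) = ⊥ := by
    have : (W.comap f).comap (LinearMap.inl K M₁ M₂) =
        (W.comap (LinearMap.inl K _ _)).comap A₁.mkQ := by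
      ext x; simp [hf]
    rw [this, comap_mkQ_eq_self_iff]
  have hinr (W : Submodule K ((M₁ ⧸ A₁) × (M₂ ⧸ A₂))) :
      (W.comap f).comap (LinearMap.inr K M₁ M₂) = A₂ ↔ W.comap (LinearMap.inr K _ _) = ⊥ := by
    have : (W.comap f).comap (LinearMap.inr K M₁ M₂) =
        (W.comap (LinearMap.inr K _ _)).comap A₂.mkQ := by
      ext x; simp [hf]
    rw [this, comap_mkQ_eq_self_iff]
  symm
  refine Nat.card_eq_of_bijective (fun W => ⟨W.1.comap f, ?_, ?_, ?_⟩) ⟨?_, ?_⟩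
  · rw [hdim, W.2.1]
  · exact (hinl _).2 W.2.2.1
  · exact (hinr _).2 W.2.2.2
  · intro W W' h
    exact Subtype.ext (Submodule.comap_injective_of_surjective hsurj (congrArg Subtype.val h))
  · rintro ⟨V, hV, h₁, h₂⟩
    have hle : LinearMap.ker f ≤ V := by
      rw [hker]
      rintro ⟨a, b⟩ ⟨ha, hb⟩
      have ha' : (a, (0 : M₂)) ∈ V := by rw [← h₁] at ha; exact ha
      have hb' : ((0 : M₁), b) ∈ V := by rw [← h₂] at hb; exact hb
      simpa using V.add_mem ha' hb'
    have hV' : (V.map f).comap f = V := Submodule.comap_map_eq_self hle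
    refine ⟨⟨V.map f, ?_, (hinl _).1 (hV'.symm ▸ h₁), (hinr _).1 (hV'.symm ▸ h₂)⟩,
      Subtype.ext hV'⟩
    have := hdim (V.map f)
    rw [hV', hV] at this
    omega

end Linear

section Frames

variable {K : Type*} [Field K] [Fintype K]
variable {W : Type*} [AddCommGroup W] [Module K W] [Finite W]

theorem card_linearIndependent_range {m : ℕ} (hm : m ≤ finrank K W) :
    Nat.card {v : Fin m → W // LinearIndependent K v} =
      ∏ i ∈ Finset.range m, (Fintype.card K ^ finrank K W - Fintype.card K ^ i) := by
  rw [card_linearIndependent hm, Finset.prod_range]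

/-- Counting subspaces of dimension `m` through their ordered bases. -/
theorem card_linearIndependent_span (m : ℕ) (p : Submodule K W → Prop)
    (hp : ∀ V, p V → finrank K V = m) :
    Nat.card {v : Fin m → W // LinearIndependent K v ∧ p (Submodule.span K (Set.range v))} =
      Nat.card {V // p V} *
        ∏ i ∈ Finset.range m, (Fintype.card K ^ m - Fintype.card K ^ i) := by
  let f : {v : Fin m → W // LinearIndependent K v ∧ p (Submodule.span K (Set.range v))} →
      {V // p V} := fun v => ⟨Submodule.span K (Set.range v.1), v.2.2⟩
  refine Nat.card_eq_card_mul_of_card_fiber f _ fun ⟨V, hV⟩ => ?_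
  have hm := hp V hV
  have hcard := card_linearIndependent_range (K := K) (W := V) hm.ge
  rw [hm] at hcard
  rw [← hcard]
  refine Nat.card_congr
    { toFun := fun v => ⟨fun i => ⟨v.1.1 i, ?_⟩, ?_⟩
      invFun := fun s => ⟨⟨fun i => s.1 i, s.2.map' V.subtype V.ker_subtype, ?_⟩, ?_⟩
      left_inv := fun v => rfl
      right_inv := fun s => rfl }
  · have h : Submodule.span K (Set.range v.1.1) = V := congrArg Subtype.val v.2
    exact h.le (Submodule.subset_span (Set.mem_range_self i))
  · exact LinearIndependent.of_comp V.subtype v.1.2.1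
  · rwa [span_range_coe_eq hm s.2]
  · exact Subtype.ext (span_range_coe_eq hm s.2)

theorem prod_pow_sub_pow_pos {q : ℕ} (hq : 1 < q) (m : ℕ) :
    0 < ∏ i ∈ Finset.range m, (q ^ m - q ^ i) :=
  Finset.prod_pos fun _ hi => Nat.sub_pos_of_lt (Nat.pow_lt_pow_right hq (Finset.mem_range.1 hi))

theorem card_finrank_eq_mul {m : ℕ} (hm : m ≤ finrank K W) :
    Nat.card {V : Submodule K W // finrank K V = m} *
        ∏ i ∈ Finset.range m, (Fintype.card K ^ m - Fintype.card K ^ i) =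
      ∏ i ∈ Finset.range m, (Fintype.card K ^ finrank K W - Fintype.card K ^ i) := by
  rw [← card_linearIndependent_span m (fun V : Submodule K W => finrank K V = m) fun _ h => h,
    ← card_linearIndependent_range hm]
  exact Nat.card_congr (Equiv.subtypeEquivRight fun v =>
    ⟨And.left, fun h => ⟨h, by rw [finrank_span_eq_card h, Fintype.card_fin]⟩⟩)

theorem card_finrank_eq_gbinom {m : ℕ} (hm : m ≤ finrank K W) :
    Nat.card {V : Submodule K W // finrank K V = m} =
      gbinom (Fintype.card K) (finrank K W : ℕ) m := by
  rw [gbinom, if_pos ⟨by positivity, by exact_mod_cast hm⟩]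
  simp only [Int.toNat_natCast]
  rw [← card_finrank_eq_mul hm,
    Nat.mul_div_cancel _ (prod_pow_sub_pow_pos Fintype.one_lt_card m)]

end Frames

section Product

variable {K : Type*} [Field K] [Fintype K]
variable {M₁ M₂ : Type*} [AddCommGroup M₁] [Module K M₁] [Finite M₁]
  [AddCommGroup M₂] [Module K M₂] [Finite M₂]

/-- The number of graphs of isomorphisms between `t`-dimensional subspaces of `M₁` and `M₂`. -/
theorem card_comap_eq_bot {t : ℕ} (h₁ : t ≤ finrank K M₁) (h₂ : t ≤ finrank K M₂) :
    Nat.card {V : Submodule K (M₁ × M₂) // finrank K V = t ∧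
        V.comap (LinearMap.inl K M₁ M₂) = ⊥ ∧ V.comap (LinearMap.inr K M₁ M₂) = ⊥} =
      (∏ i ∈ Finset.range t, (Fintype.card K ^ t - Fintype.card K ^ i)) *
        gbinom (Fintype.card K) (finrank K M₁ : ℕ) t *
        gbinom (Fintype.card K) (finrank K M₂ : ℕ) t := by
  refine Nat.eq_of_mul_eq_mul_right
    (prod_pow_sub_pow_pos (Fintype.one_lt_card (α := K)) t) ?_
  rw [← card_linearIndependent_span t _ fun _ h => h.1]
  have e : {v : Fin t → M₁ × M₂ // LinearIndependent K v ∧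
        finrank K (Submodule.span K (Set.range v)) = t ∧
        (Submodule.span K (Set.range v)).comap (LinearMap.inl K M₁ M₂) = ⊥ ∧
        (Submodule.span K (Set.range v)).comap (LinearMap.inr K M₁ M₂) = ⊥} ≃
      {v : Fin t → M₁ // LinearIndependent K v} × {v : Fin t → M₂ // LinearIndependent K v} := by
    refine (Equiv.subtypeEquiv (Equiv.arrowProdEquivProdArrow _ _ _) fun v => ?_).trans
      (Equiv.subtypeProdEquivProd (p := fun v : Fin t → M₁ => LinearIndependent K v)
        (q := fun v : Fin t → M₂ => LinearIndependent K v))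
    have e₁ := linearIndependent_comp_iff (LinearMap.fst K M₁ M₂) v
    have e₂ := linearIndependent_comp_iff (LinearMap.snd K M₁ M₂) v
    rw [comap_inl_eq_bot_iff, comap_inr_eq_bot_iff]
    change _ ↔ LinearIndependent K (LinearMap.fst K M₁ M₂ ∘ v) ∧
      LinearIndependent K (LinearMap.snd K M₁ M₂ ∘ v)
    rw [e₁, e₂]
    have hdim (h : LinearIndependent K v) :
        finrank K (Submodule.span K (Set.range v)) = t := by
      rw [finrank_span_eq_card h, Fintype.card_fin]
    tauto
  rw [Nat.card_congr e, Nat.card_prod, card_linearIndependent_range h₁,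
    card_linearIndependent_range h₂, ← card_finrank_eq_mul h₁, ← card_finrank_eq_mul h₂,
    card_finrank_eq_gbinom h₁, card_finrank_eq_gbinom h₂]
  ring

/-- The number of subspaces of a product with prescribed dimensions of the intersections with the
two factors. -/
theorem card_finrank_comap_eq {t t₁ t₂ : ℕ} (h₁ : t₁ ≤ finrank K M₁) (h₂ : t₂ ≤ finrank K M₂)
    (ht₁ : t ≤ finrank K M₁ - t₁) (ht₂ : t ≤ finrank K M₂ - t₂) :
    Nat.card {V : Submodule K (M₁ × M₂) // finrank K V = t + t₁ + t₂ ∧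
        finrank K (V.comap (LinearMap.inl K M₁ M₂)) = t₁ ∧
        finrank K (V.comap (LinearMap.inr K M₁ M₂)) = t₂} =
      gbinom (Fintype.card K) (finrank K M₁ : ℕ) t₁ *
        gbinom (Fintype.card K) (finrank K M₂ : ℕ) t₂ *
      ((∏ i ∈ Finset.range t, (Fintype.card K ^ t - Fintype.card K ^ i)) *
        gbinom (Fintype.card K) (finrank K M₁ - t₁ : ℕ) t *
        gbinom (Fintype.card K) (finrank K M₂ - t₂ : ℕ) t) := by
  rw [← card_finrank_eq_gbinom h₁, ← card_finrank_eq_gbinom h₂, ← Nat.card_prod]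
  let f : {V : Submodule K (M₁ × M₂) // finrank K V = t + t₁ + t₂ ∧
        finrank K (V.comap (LinearMap.inl K M₁ M₂)) = t₁ ∧
        finrank K (V.comap (LinearMap.inr K M₁ M₂)) = t₂} →
      {A : Submodule K M₁ // finrank K A = t₁} × {A : Submodule K M₂ // finrank K A = t₂} :=
    fun V => (⟨_, V.2.2.1⟩, ⟨_, V.2.2.2⟩)
  refine Nat.card_eq_card_mul_of_card_fiber f _ ?_
  rintro ⟨⟨A₁, hA₁⟩, ⟨A₂, hA₂⟩⟩
  have hq₁ : finrank K (M₁ ⧸ A₁) = finrank K M₁ - t₁ := by rw [A₁.finrank_quotient, hA₁]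
  have hq₂ : finrank K (M₂ ⧸ A₂) = finrank K M₂ - t₂ := by rw [A₂.finrank_quotient, hA₂]
  have := Finite.of_surjective _ A₁.mkQ_surjective
  have := Finite.of_surjective _ A₂.mkQ_surjective
  rw [← hq₁, ← hq₂, ← card_comap_eq_bot (hq₁ ▸ ht₁) (hq₂ ▸ ht₂), ← card_comap_eq]
  refine Nat.card_congr
    { toFun := fun V => ⟨V.1.1, ?_, ?_, ?_⟩
      invFun := fun V => ⟨⟨V.1, ?_, ?_, ?_⟩, ?_⟩
      left_inv := fun V => rfl
      right_inv := fun V => rfl }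
  · rw [V.1.2.1, hA₁, hA₂]
  · exact congrArg (fun A => A.1.1) V.2
  · exact congrArg (fun A => A.2.1) V.2
  · rw [V.2.1, hA₁, hA₂]
  · rw [V.2.2.1, hA₁]
  · rw [V.2.2.2, hA₂]
  · exact Prod.ext (Subtype.ext V.2.2.1) (Subtype.ext V.2.2.2)

end Product

/-- Subspaces of an internal direct sum correspond to subspaces of the product. -/
theorem card_le_sup_eq {K W : Type*} [Field K] [AddCommGroup W] [Module K W]
    {S₁ S₂ : Submodule K W} (hS : S₁ ⊓ S₂ = ⊥) (d t₁ t₂ : ℕ) :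
    Nat.card {V : Submodule K W // V ≤ S₁ ⊔ S₂ ∧ finrank K V = d ∧
        finrank K ↥(V ⊓ S₁) = t₁ ∧ finrank K ↥(V ⊓ S₂) = t₂} =
      Nat.card {V : Submodule K (S₁ × S₂) // finrank K V = d ∧
        finrank K (V.comap (LinearMap.inl K S₁ S₂)) = t₁ ∧
        finrank K (V.comap (LinearMap.inr K S₁ S₂)) = t₂} := by
  set f : S₁ × S₂ →ₗ[K] W := S₁.subtype.coprod S₂.subtype with hf
  have hrange : LinearMap.range f = S₁ ⊔ S₂ := by
    simp [hf, LinearMap.range_coprod]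
  have hinj : Function.Injective f := by
    rw [← LinearMap.ker_eq_bot, hf, LinearMap.ker_coprod_of_disjoint_range]
    · simp
    · simpa [disjoint_iff] using hS
  have hinl (V : Submodule K W) :
      finrank K ((V.comap f).comap (LinearMap.inl K S₁ S₂)) = finrank K ↥(V ⊓ S₁) := by
    rw [← Submodule.comap_comp, hf, LinearMap.coprod_inl,
      finrank_comap_of_injective S₁.injective_subtype, Submodule.range_subtype]
  have hinr (V : Submodule K W) :
      finrank K ((V.comap f).comap (LinearMap.inr K S₁ S₂)) = finrank K ↥(V ⊓ S₂) := by
    rw [← Submodule.comap_comp, hf, LinearMap.coprod_inr,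
      finrank_comap_of_injective S₂.injective_subtype, Submodule.range_subtype]
  have hdim {V : Submodule K W} (hV : V ≤ S₁ ⊔ S₂) : finrank K (V.comap f) = finrank K V := by
    rw [finrank_comap_of_injective hinj, hrange, inf_eq_left.2 hV]
  refine Nat.card_eq_of_bijective (fun V => ⟨V.1.comap f, ?_, ?_, ?_⟩) ⟨?_, ?_⟩
  · rw [hdim V.2.1, V.2.2.1]
  · rw [hinl, V.2.2.2.1]
  · rw [hinr, V.2.2.2.2]
  · rintro ⟨V, hV, hV₀⟩ ⟨V', hV', hV₀'⟩ h
    have h' : V.comap f = V'.comap f := congrArg Subtype.val h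
    have := congrArg (Submodule.map f) h'
    rw [Submodule.map_comap_eq, Submodule.map_comap_eq, hrange, inf_eq_right.2 hV,
      inf_eq_right.2 hV'] at this
    exact Subtype.ext this
  · rintro ⟨V, hV, h₁, h₂⟩
    have hV' : (V.map f).comap f = V := Submodule.comap_map_eq_of_injective hinj V
    have hle : V.map f ≤ S₁ ⊔ S₂ := hrange ▸ LinearMap.map_le_range
    refine ⟨⟨V.map f, hle, ?_, ?_, ?_⟩, Subtype.ext hV'⟩
    · rw [← hdim hle, hV', hV]
    · rw [← hinl, hV', h₁]
    · rw [← hinr, hV', h₂]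

/-- For subspaces `S1, S2` of `F_q^k` of dimensions `u1, u2` with `S1 ∩ S2 = {0}`,
and `0 ≤ t1 ≤ u1`, `0 ≤ t2 ≤ u2`, `0 ≤ t ≤ min(u1-t1, u2-t2)`: the number of
`(t+t1+t2)`-dimensional subspaces `V` of `S1 + S2` with `dim(V ∩ S1) = t1` and
`dim(V ∩ S2) = t2` equals
`(q^t-1)(q^t-q)⋯(q^t-q^{t-1}) [u1-t1,t]_q [u2-t2,t]_q [u1,t1]_q [u2,t2]_q` when `t ≥ 1`,
and `[u1,t1]_q [u2,t2]_q` when `t = 0`. -/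
theorem stmt_9 (q k u1 u2 t1 t2 t : ℕ)
    (F : Type) [Field F] [Fintype F] (hF : Fintype.card F = q)
    (S1 S2 : Submodule F (Fin k → F))
    (h1 : Module.finrank F S1 = u1) (h2 : Module.finrank F S2 = u2)
    (hdisj : S1 ⊓ S2 = ⊥)
    (ht1 : t1 ≤ u1) (ht2 : t2 ≤ u2) (ht : t ≤ min (u1 - t1) (u2 - t2)) :
    Nat.card {V : Submodule F (Fin k → F) //
        V ≤ S1 ⊔ S2 ∧ Module.finrank F V = t + t1 + t2 ∧
        Module.finrank F ↥(V ⊓ S1) = t1 ∧ Module.finrank F ↥(V ⊓ S2) = t2} =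
      if t = 0 then gbinom q u1 t1 * gbinom q u2 t2
      else (∏ s ∈ Finset.range t, (q ^ t - q ^ s)) *
        gbinom q ((u1 : ℤ) - t1) t * gbinom q ((u2 : ℤ) - t2) t *
        gbinom q u1 t1 * gbinom q u2 t2 := by
  subst hF h1 h2
  rw [card_le_sup_eq hdisj, card_finrank_comap_eq ht1 ht2 (ht.trans (min_le_left _ _))
    (ht.trans (min_le_right _ _)), Nat.cast_sub ht1, Nat.cast_sub ht2]
  split_ifs with h0
  · subst h0
    simp [gbinom, ht1, ht2]
  · ring
end

section
/- Assume in addition that u1 ≠ u2. Then the columns of G span F_q^k, so C is an [n, k] linear code with n = q^k − q^{u1} − q^{u2} + 1, and its weight distribution is as follows: the number of codewords of C of Hamming weight w equals 1 for w = 0; q^{k−u1−u2} − 1 for w = q^k − q^{k−1}; q^{k−u1} − q^{k−u1−u2} for w = (q−1)(q^{k−1} − q^{u2−1}); q^{k−u2} − q^{k−u1−u2} for w = (q−1)(q^{k−1} − q^{u1−1}); q^{k−u1−u2}(q^{u1} − 1)(q^{u2} − 1) for w = (q−1)(q^{k−1} − q^{u1−1} − q^{u2−1}); and 0 for every other value of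 w. In particular, the minimum Hamming weight of a nonzero codeword of C is (q−1)(q^{k−1} − q^{u1−1} − q^{u2−1}). -/
open Matrix Module

section SolomonStiffler

variable {F V : Type*} [Field F] [AddCommGroup V] [Module F V]

/-- A nonzero functional on an `F_q`-space of dimension `d` is nonzero at exactly
`(q - 1) q ^ (d - 1)` points. -/
theorem ncard_dual_ne_zero [Fintype F] [FiniteDimensional F V] {f : Dual F V} (hf : f ≠ 0) :
    {v | f v ≠ 0}.ncard = (Fintype.card F - 1) * Fintype.card F ^ (finrank F V - 1) := by
  have : Finite V := Module.finite_of_finite F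
  have hker := Dual.finrank_ker_add_one_of_ne_zero hf
  have hcompl := Set.ncard_add_ncard_compl (LinearMap.ker f : Set V)
  have hc : (LinearMap.ker f : Set V)ᶜ = {v | f v ≠ 0} := by ext; simp
  have hk : (LinearMap.ker f : Set V).ncard = Fintype.card F ^ finrank F (LinearMap.ker f) := by
    rw [← Nat.card_eq_fintype_card, ← Module.natCard_eq_pow_finrank]
    rfl
  rw [hc, hk, Module.natCard_eq_pow_finrank (K := F) (V := V), ← hker, pow_succ,
    Nat.card_eq_fintype_card] at hcompl
  rw [← hker, Nat.add_sub_cancel, Nat.sub_mul, one_mul, mul_comm (Fintype.card F)]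
  omega

open Classical in
theorem ncard_inter_dual_ne_zero [Fintype F] [FiniteDimensional F V] (f : Dual F V)
    (S : Submodule F V) :
    ((S : Set V) ∩ {v | f v ≠ 0}).ncard = if f ∈ S.dualAnnihilator then 0 else
      (Fintype.card F - 1) * Fintype.card F ^ (finrank F S - 1) := by
  have himage : (S : Set V) ∩ {v | f v ≠ 0} = Subtype.val '' {v : S | f.domRestrict S v ≠ 0} := by
    ext v; simp [and_comm]
  rw [himage, Set.ncard_image_of_injective _ Subtype.val_injective]
  have hzero : f ∈ S.dualAnnihilator ↔ f.domRestrict S = 0 := by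
    rw [Submodule.mem_dualAnnihilator, LinearMap.ext_iff]
    simp
  split_ifs with h
  · simp [hzero.1 h]
  · exact ncard_dual_ne_zero (mt hzero.2 h)

/-- The weight of the codeword given by the values of `f` off `S₁ ∪ S₂`, together with the
number of points of `S₁` and of `S₂` where `f` is nonzero, counts all points where `f` is
nonzero. -/
theorem hammingNorm_add_ncard [DecidableEq F] [Finite V] {ι : Type*} [Fintype ι]
    {v : ι → V} (hv : Function.Injective v) {S₁ S₂ : Submodule F V} (hdisj : S₁ ⊓ S₂ = ⊥)
    (hran : Set.range v = ((S₁ : Set V) ∪ (S₂ : Set V))ᶜ) (f : Dual F V) :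
    hammingNorm (fun i => f (v i)) + ((S₁ : Set V) ∩ {v | f v ≠ 0}).ncard +
      ((S₂ : Set V) ∩ {v | f v ≠ 0}).ncard = {v | f v ≠ 0}.ncard := by
  have hw : hammingNorm (fun i => f (v i)) = (Set.range v ∩ {v | f v ≠ 0}).ncard := by
    have himage : Set.range v ∩ {v | f v ≠ 0} = v '' {i | f (v i) ≠ 0} := by
      ext x
      constructor
      · rintro ⟨⟨i, rfl⟩, hx⟩
        exact ⟨i, hx, rfl⟩
      · rintro ⟨i, hi, rfl⟩
        exact ⟨⟨i, rfl⟩, hi⟩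
    rw [himage, Set.ncard_image_of_injective _ hv, hammingNorm, ← Set.ncard_coe_finset]
    simp
  have hd : Disjoint ((S₁ : Set V) ∩ {v | f v ≠ 0}) ((S₂ : Set V) ∩ {v | f v ≠ 0}) := by
    rw [Set.disjoint_left]
    rintro x ⟨hx₁, hx⟩ ⟨hx₂, -⟩
    have : x ∈ S₁ ⊓ S₂ := ⟨hx₁, hx₂⟩
    rw [hdisj, Submodule.mem_bot] at this
    exact hx (by simp [this])
  rw [hw, add_assoc, ← Set.ncard_union_eq hd, ← Set.union_inter_distrib_right, hran,
    ← Set.ncard_union_eq, ← Set.union_inter_distrib_right, Set.compl_union_self, Set.univ_inter]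
  exact (disjoint_compl_left).mono Set.inter_subset_left Set.inter_subset_left

/-- The weight of the codeword of `f`, according to which of `S₁`, `S₂` it annihilates. -/
theorem hammingNorm_dual_eq [Fintype F] [DecidableEq F] [FiniteDimensional F V]
    {ι : Type*} [Fintype ι]
    {v : ι → V} (hv : Function.Injective v) {S₁ S₂ : Submodule F V} (hdisj : S₁ ⊓ S₂ = ⊥)
    (hran : Set.range v = ((S₁ : Set V) ∪ (S₂ : Set V))ᶜ) {f : Dual F V} (hf : f ≠ 0) :
    (f ∈ S₁.dualAnnihilator → f ∈ S₂.dualAnnihilator → hammingNorm (fun i => f (v i)) =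
      (Fintype.card F - 1) * Fintype.card F ^ (finrank F V - 1)) ∧
    (f ∈ S₁.dualAnnihilator → f ∉ S₂.dualAnnihilator → hammingNorm (fun i => f (v i)) =
      (Fintype.card F - 1) *
        (Fintype.card F ^ (finrank F V - 1) - Fintype.card F ^ (finrank F S₂ - 1))) ∧
    (f ∉ S₁.dualAnnihilator → f ∈ S₂.dualAnnihilator → hammingNorm (fun i => f (v i)) =
      (Fintype.card F - 1) *
        (Fintype.card F ^ (finrank F V - 1) - Fintype.card F ^ (finrank F S₁ - 1))) ∧
    (f ∉ S₁.dualAnnihilator → f ∉ S₂.dualAnnihilator → hammingNorm (fun i => f (v i)) =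
      (Fintype.card F - 1) * (Fintype.card F ^ (finrank F V - 1) -
        Fintype.card F ^ (finrank F S₁ - 1) - Fintype.card F ^ (finrank F S₂ - 1))) := by
  have : Finite V := Module.finite_of_finite F
  have h := hammingNorm_add_ncard hv hdisj hran f
  rw [ncard_inter_dual_ne_zero, ncard_inter_dual_ne_zero, ncard_dual_ne_zero hf] at h
  refine ⟨fun m₁ m₂ => ?_, fun m₁ m₂ => ?_, fun m₁ m₂ => ?_, fun m₁ m₂ => ?_⟩ <;>
    simp only [m₁, m₂, if_true, if_false] at h <;> (try simp only [Nat.mul_sub]) <;> omega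

theorem ncard_dualAnnihilator [Fintype F] [FiniteDimensional F V] (S : Submodule F V) :
    (S.dualAnnihilator : Set (Dual F V)).ncard =
      Fintype.card F ^ (finrank F V - finrank F S) := by
  have h := Subspace.finrank_add_finrank_dualAnnihilator_eq S
  rw [← Nat.card_eq_fintype_card, ← h, Nat.add_sub_cancel_left]
  exact Module.natCard_eq_pow_finrank (K := F) (V := S.dualAnnihilator)

theorem ncard_dualAnnihilator_inter [Fintype F] [FiniteDimensional F V] {S₁ S₂ : Submodule F V}
    (hdisj : S₁ ⊓ S₂ = ⊥) :
    ((S₁.dualAnnihilator : Set (Dual F V)) ∩ S₂.dualAnnihilator).ncard =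
      Fintype.card F ^ (finrank F V - finrank F S₁ - finrank F S₂) := by
  have h := Submodule.finrank_sup_add_finrank_inf_eq S₁ S₂
  rw [hdisj, finrank_bot, add_zero] at h
  rw [← Submodule.coe_inf, ← Submodule.dualAnnihilator_sup_eq, ncard_dualAnnihilator, h,
    Nat.sub_sub]

/-- With `u₁ ≠ u₂` the sum `q ^ (u₁ - 1) + q ^ (u₂ - 1)` stays below `q ^ (k - 1)`. -/
theorem pow_pred_add_pow_pred_lt {q k u₁ u₂ : ℕ} (hq : 2 ≤ q) (hu₁ : 1 ≤ u₁) (hu₂ : 1 ≤ u₂)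
    (huk : u₁ + u₂ ≤ k) (hne : u₁ ≠ u₂) : q ^ (u₁ - 1) + q ^ (u₂ - 1) < q ^ (k - 1) := by
  wlog h : u₁ < u₂ generalizing u₁ u₂
  · rw [add_comm]
    exact this hu₂ hu₁ (by omega) hne.symm (by omega)
  have h₁ : q ^ (u₁ - 1) < q ^ (u₂ - 1) := Nat.pow_lt_pow_right hq (by omega)
  have h₂ : q ^ (u₂ - 1 + 1) ≤ q ^ (k - 1) := Nat.pow_le_pow_right (by omega) (by omega)
  rw [pow_succ] at h₂
  have h₃ := Nat.mul_le_mul_left (q ^ (u₂ - 1)) hq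
  omega

theorem pow_sub_pow_pred {q k : ℕ} (hk : 1 ≤ k) : q ^ k - q ^ (k - 1) = (q - 1) * q ^ (k - 1) := by
  obtain ⟨k, rfl⟩ := Nat.exists_eq_add_of_le' hk
  rw [Nat.add_sub_cancel, pow_succ, Nat.sub_mul, one_mul, mul_comm q]

theorem ncard_compl_union_dualAnnihilator [Fintype F] [FiniteDimensional F V]
    {S₁ S₂ : Submodule F V} (hdisj : S₁ ⊓ S₂ = ⊥) :
    ((S₁.dualAnnihilator : Set (Dual F V)) ∪ S₂.dualAnnihilator)ᶜ.ncard =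
      Fintype.card F ^ (finrank F V - finrank F S₁ - finrank F S₂) *
        (Fintype.card F ^ finrank F S₁ - 1) * (Fintype.card F ^ finrank F S₂ - 1) := by
  have : Finite (Dual F V) := Module.finite_of_finite F
  have hle : finrank F S₁ + finrank F S₂ ≤ finrank F V := by
    have h := Submodule.finrank_sup_add_finrank_inf_eq S₁ S₂
    rw [hdisj, finrank_bot, add_zero] at h
    exact h ▸ Submodule.finrank_le _
  have hunion := Set.ncard_union_add_ncard_inter (S₁.dualAnnihilator : Set (Dual F V))
    S₂.dualAnnihilator
  have hcompl := Set.ncard_add_ncard_compl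
    ((S₁.dualAnnihilator : Set (Dual F V)) ∪ S₂.dualAnnihilator)
  rw [ncard_dualAnnihilator_inter hdisj, ncard_dualAnnihilator, ncard_dualAnnihilator] at hunion
  rw [Module.natCard_eq_pow_finrank (K := F), Subspace.dual_finrank_eq,
    Nat.card_eq_fintype_card] at hcompl
  generalize finrank F S₁ = u₁ at *
  generalize finrank F S₂ = u₂ at *
  obtain ⟨d, hd⟩ := Nat.exists_eq_add_of_le hle
  rw [hd, show u₁ + u₂ + d - u₁ = d + u₂ by omega, show u₁ + u₂ + d - u₂ = d + u₁ by omega,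
    show d + u₂ - u₂ = d by omega] at hunion
  rw [hd, show u₁ + u₂ + d - u₁ - u₂ = d by omega]
  rw [hd] at hcompl
  have h₁ : 1 ≤ Fintype.card F ^ u₁ := Nat.pos_of_ne_zero (by simp)
  have h₂ : 1 ≤ Fintype.card F ^ u₂ := Nat.pos_of_ne_zero (by simp)
  simp only [pow_add] at hunion hcompl
  zify [h₁, h₂] at *
  linear_combination hcompl - hunion

/-- Weight distribution of the code, with codewords indexed by functionals. -/
theorem ncard_hammingNorm_dual_eq [Fintype F] [DecidableEq F] [FiniteDimensional F V]
    {ι : Type*} [Fintype ι] {v : ι → V} (hv : Function.Injective v)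
    {S₁ S₂ : Submodule F V} (hdisj : S₁ ⊓ S₂ = ⊥)
    (hran : Set.range v = ((S₁ : Set V) ∪ (S₂ : Set V))ᶜ) {q k u₁ u₂ : ℕ}
    (hq : Fintype.card F = q) (hk : finrank F V = k)
    (hS₁ : finrank F S₁ = u₁) (hS₂ : finrank F S₂ = u₂) (hu₁ : 1 ≤ u₁) (hu₂ : 1 ≤ u₂)
    (huk : u₁ + u₂ ≤ k) (hne : u₁ ≠ u₂) (w : ℕ) :
    {f : Dual F V | hammingNorm (fun i => f (v i)) = w}.ncard =
      if w = 0 then 1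
      else if w = q ^ k - q ^ (k - 1) then q ^ (k - u₁ - u₂) - 1
      else if w = (q - 1) * (q ^ (k - 1) - q ^ (u₂ - 1)) then
        q ^ (k - u₁) - q ^ (k - u₁ - u₂)
      else if w = (q - 1) * (q ^ (k - 1) - q ^ (u₁ - 1)) then
        q ^ (k - u₂) - q ^ (k - u₁ - u₂)
      else if w = (q - 1) * (q ^ (k - 1) - q ^ (u₁ - 1) - q ^ (u₂ - 1)) then
        q ^ (k - u₁ - u₂) * (q ^ u₁ - 1) * (q ^ u₂ - 1)
      else 0 := by
  have : Finite (Dual F V) := Module.finite_of_finite F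
  have hq₂ : 2 ≤ q := hq ▸ Fintype.one_lt_card
  have hwt := fun f (hf : f ≠ 0) => hammingNorm_dual_eq hv hdisj hran (f := f) hf
  have hwt₀ : hammingNorm (fun i => (0 : Dual F V) (v i)) = 0 := by
    simp [hammingNorm]
  have hinter := ncard_dualAnnihilator_inter hdisj
  have hA₁ := ncard_dualAnnihilator S₁
  have hA₂ := ncard_dualAnnihilator S₂
  have hcompl := ncard_compl_union_dualAnnihilator hdisj
  rw [hq, hk, hS₁, hS₂] at hinter hcompl
  rw [hq, hk, hS₁] at hA₁
  rw [hq, hk, hS₂] at hA₂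
  simp only [hq, hk, hS₁, hS₂] at hwt
  have hd₁ := Set.ncard_inter_add_ncard_sdiff_eq_ncard (S₁.dualAnnihilator : Set (Dual F V))
    S₂.dualAnnihilator
  have hd₂ := Set.ncard_inter_add_ncard_sdiff_eq_ncard (S₂.dualAnnihilator : Set (Dual F V))
    S₁.dualAnnihilator
  rw [Set.inter_comm] at hd₂
  rw [hinter, hA₁] at hd₁
  rw [hinter, hA₂] at hd₂
  rw [pow_sub_pow_pred (by omega)]
  have hlt := pow_pred_add_pow_pred_lt hq₂ hu₁ hu₂ huk hne
  have hne' : q ^ (u₁ - 1) ≠ q ^ (u₂ - 1) := fun h => by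
    have := Nat.pow_right_injective hq₂ h
    omega
  have hpos₁ : 0 < q ^ (u₁ - 1) := by positivity
  have hpos₂ : 0 < q ^ (u₂ - 1) := by positivity
  have hp : 0 < q - 1 := by omega
  generalize q ^ (k - 1) = m at *
  generalize q ^ (u₁ - 1) = a at *
  generalize q ^ (u₂ - 1) = b at *
  generalize q - 1 = p at *
  have hlevel : ∀ {X : Set (Dual F V)},
      (∀ f, hammingNorm (fun i => f (v i)) = w ↔ f ∈ X) →
        {f : Dual F V | hammingNorm (fun i => f (v i)) = w}.ncard = X.ncard :=
    fun h => congrArg Set.ncard (Set.ext h)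
  have hm : p * m ≠ 0 := (Nat.mul_pos hp (by omega)).ne'
  have hmb : p * (m - b) ≠ 0 := (Nat.mul_pos hp (by omega)).ne'
  have hma : p * (m - a) ≠ 0 := (Nat.mul_pos hp (by omega)).ne'
  have hmab : p * (m - a - b) ≠ 0 := (Nat.mul_pos hp (by omega)).ne'
  have hcancel : ∀ {x y}, x ≠ y → p * x ≠ p * y := fun h h' => h (Nat.eq_of_mul_eq_mul_left hp h')
  have h₀₁ := hcancel (show m ≠ m - b by omega)
  have h₀₂ := hcancel (show m ≠ m - a by omega)
  have h₀₃ := hcancel (show m ≠ m - a - b by omega)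
  have h₁₂ := hcancel (show m - b ≠ m - a by omega)
  have h₁₃ := hcancel (show m - b ≠ m - a - b by omega)
  have h₂₃ := hcancel (show m - a ≠ m - a - b by omega)
  have hz₁ := S₁.dualAnnihilator.zero_mem
  have hz₂ := S₂.dualAnnihilator.zero_mem
  generalize p * m = W₀ at *
  generalize p * (m - b) = W₁ at *
  generalize p * (m - a) = W₂ at *
  generalize p * (m - a - b) = W₃ at *
  have hclass : ∀ f : Dual F V,
      (f = 0 ∧ hammingNorm (fun i => f (v i)) = 0) ∨
      (f ≠ 0 ∧ f ∈ S₁.dualAnnihilator ∧ f ∈ S₂.dualAnnihilator ∧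
        hammingNorm (fun i => f (v i)) = W₀) ∨
      (f ≠ 0 ∧ f ∈ S₁.dualAnnihilator ∧ f ∉ S₂.dualAnnihilator ∧
        hammingNorm (fun i => f (v i)) = W₁) ∨
      (f ≠ 0 ∧ f ∉ S₁.dualAnnihilator ∧ f ∈ S₂.dualAnnihilator ∧
        hammingNorm (fun i => f (v i)) = W₂) ∨
      (f ≠ 0 ∧ f ∉ S₁.dualAnnihilator ∧ f ∉ S₂.dualAnnihilator ∧
        hammingNorm (fun i => f (v i)) = W₃) := by
    intro f
    by_cases hf : f = 0
    · exact Or.inl ⟨hf, hf ▸ hwt₀⟩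
    · obtain ⟨e₀, e₁, e₂, e₃⟩ := hwt f hf
      by_cases m₁ : f ∈ S₁.dualAnnihilator <;> by_cases m₂ : f ∈ S₂.dualAnnihilator
      · exact Or.inr (Or.inl ⟨hf, m₁, m₂, e₀ m₁ m₂⟩)
      · exact Or.inr (Or.inr (Or.inl ⟨hf, m₁, m₂, e₁ m₁ m₂⟩))
      · exact Or.inr (Or.inr (Or.inr (Or.inl ⟨hf, m₁, m₂, e₂ m₁ m₂⟩)))
      · exact Or.inr (Or.inr (Or.inr (Or.inr ⟨hf, m₁, m₂, e₃ m₁ m₂⟩)))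
  split_ifs with c c₀ c₁ c₂ c₃
  · rw [hlevel (X := {0}), Set.ncard_singleton]
    intro f
    have hf := hclass f
    rw [Set.mem_singleton_iff]
    clear hwt hlevel hclass
    grind
  · rw [hlevel (X := (S₁.dualAnnihilator ∩ S₂.dualAnnihilator) \ {0}),
      Set.ncard_sdiff_singleton_of_mem (Set.mem_inter hz₁ hz₂), hinter]
    intro f
    simp only [Set.mem_sdiff, Set.mem_inter_iff, SetLike.mem_coe, Set.mem_singleton_iff]
    have hf := hclass f
    clear hwt hlevel hclass
    grind
  · rw [hlevel (X := S₁.dualAnnihilator \ S₂.dualAnnihilator)]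
    · omega
    intro f
    simp only [Set.mem_sdiff, SetLike.mem_coe]
    have hf := hclass f
    clear hwt hlevel hclass
    grind
  · rw [hlevel (X := S₂.dualAnnihilator \ S₁.dualAnnihilator)]
    · omega
    intro f
    simp only [Set.mem_sdiff, SetLike.mem_coe]
    have hf := hclass f
    clear hwt hlevel hclass
    grind
  · rw [hlevel (X := (S₁.dualAnnihilator ∪ S₂.dualAnnihilator)ᶜ), hcompl]
    intro f
    simp only [Set.mem_compl_iff, Set.mem_union, SetLike.mem_coe]
    have hf := hclass f
    clear hwt hlevel hclass
    grind
  · rw [hlevel (X := ∅), Set.ncard_empty]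
    intro f
    have hf := hclass f
    rw [Set.mem_empty_iff_false]
    clear hwt hlevel hclass
    grind

end SolomonStiffler

/-- Weight distribution of the Solomon–Stiffler code with `p = 2` and `u1 ≠ u2`:
the columns of `G` span `F_q^k`, and the number of codewords of `C` of Hamming
weight `w` is: `1` for `w = 0`; `q^{k-u1-u2} - 1` for `w = q^k - q^{k-1}`;
`q^{k-u1} - q^{k-u1-u2}` for `w = (q-1)(q^{k-1} - q^{u2-1})`;
`q^{k-u2} - q^{k-u1-u2}` for `w = (q-1)(q^{k-1} - q^{u1-1})`;
`q^{k-u1-u2}(q^{u1}-1)(q^{u2}-1)` for `w = (q-1)(q^{k-1} - q^{u1-1} - q^{u2-1})`;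
and `0` otherwise.  In particular the minimum weight of a nonzero codeword is
`(q-1)(q^{k-1} - q^{u1-1} - q^{u2-1})`. -/
theorem stmt_14 (q k n u1 u2 : ℕ) (hu1 : 1 ≤ u1) (hu2 : 1 ≤ u2) (huk : u1 + u2 ≤ k)
    (hne : u1 ≠ u2)
    (F : Type) [Field F] [Fintype F] [DecidableEq F] (hF : Fintype.card F = q)
    (S1 S2 : Submodule F (Fin k → F))
    (h1 : Module.finrank F S1 = u1) (h2 : Module.finrank F S2 = u2)
    (hdisj : S1 ⊓ S2 = ⊥)
    (G : Matrix (Fin k) (Fin n) F)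
    (hinj : Function.Injective fun c : Fin n => (fun r => G r c))
    (hran : Set.range (fun c : Fin n => (fun r => G r c)) =
      ((S1 : Set (Fin k → F)) ∪ (S2 : Set (Fin k → F)))ᶜ)
    (hn : (n : ℤ) = (q : ℤ) ^ k - (q : ℤ) ^ u1 - (q : ℤ) ^ u2 + 1) :
    Submodule.span F (Set.range fun c : Fin n => (fun r => G r c)) = ⊤ ∧
    (∀ w : ℕ,
      Nat.card {c : Fin n → F // (∃ x : Fin k → F, Matrix.vecMul x G = c) ∧ hammingNorm c = w} =
        if w = 0 then 1
        else if w = q ^ k - q ^ (k - 1) then q ^ (k - u1 - u2) - 1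
        else if w = (q - 1) * (q ^ (k - 1) - q ^ (u2 - 1)) then
          q ^ (k - u1) - q ^ (k - u1 - u2)
        else if w = (q - 1) * (q ^ (k - 1) - q ^ (u1 - 1)) then
          q ^ (k - u2) - q ^ (k - u1 - u2)
        else if w = (q - 1) * (q ^ (k - 1) - q ^ (u1 - 1) - q ^ (u2 - 1)) then
          q ^ (k - u1 - u2) * (q ^ u1 - 1) * (q ^ u2 - 1)
        else 0) ∧
    sInf {w | ∃ c : Fin n → F,
        (∃ x : Fin k → F, Matrix.vecMul x G = c) ∧ c ≠ 0 ∧ hammingNorm c = w} =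
      (q - 1) * (q ^ (k - 1) - q ^ (u1 - 1) - q ^ (u2 - 1)) := by
  have hv := hinj
  have hk : finrank F (Fin k → F) = k := by simp
  have hq₂ : 2 ≤ q := hF ▸ Fintype.one_lt_card
  have hcount := ncard_hammingNorm_dual_eq hv hdisj hran hF hk h1 h2 hu1 hu2 huk hne
  have hlt := pow_pred_add_pow_pred_lt hq₂ hu1 hu2 huk hne
  set v : Fin n → Fin k → F := fun c r => G r c
  have hzero : ∀ f : Dual F (Fin k → F), (∀ i, f (v i) = 0) → f = 0 := by
    have h := hcount 0
    rw [if_pos rfl, Set.ncard_eq_one] at h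
    obtain ⟨f₀, hf₀⟩ := h
    have hmem : ∀ f : Dual F (Fin k → F), (∀ i, f (v i) = 0) → f = f₀ := fun f hf => by
      have : f ∈ {f : Dual F (Fin k → F) | hammingNorm (fun i => f (v i)) = 0} := by
        simpa [hammingNorm_eq_zero, funext_iff] using hf
      rwa [hf₀] at this
    exact fun f hf => (hmem f hf).trans (hmem 0 fun _ => rfl).symm
  have hcode : ∀ c : Fin n → F, (∃ x : Fin k → F, Matrix.vecMul x G = c) ↔
      ∃ f : Dual F (Fin k → F), (fun i => f (v i)) = c := by
    intro c
    rw [(dotProductEquiv F (Fin k)).surjective.exists]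
    rfl
  have hcard : ∀ w, Nat.card {c : Fin n → F //
      (∃ x : Fin k → F, Matrix.vecMul x G = c) ∧ hammingNorm c = w} =
        {f : Dual F (Fin k → F) | hammingNorm (fun i => f (v i)) = w}.ncard := by
    intro w
    have hinjective : Function.Injective fun (f : Dual F (Fin k → F)) (i : Fin n) => f (v i) :=
      fun f g hfg => sub_eq_zero.1 <| hzero _ fun i => by
        simpa [sub_eq_zero] using congrFun hfg i
    rw [← Set.ncard_image_of_injective _ hinjective]
    refine Nat.card_congr (Equiv.setCongr (Set.ext fun c => ?_))
    simp only [hcode, Set.mem_ofPred_eq, Set.mem_image]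
    constructor
    · rintro ⟨⟨f, rfl⟩, hf⟩
      exact ⟨f, hf, rfl⟩
    · rintro ⟨f, hf, rfl⟩
      exact ⟨⟨f, rfl⟩, hf⟩
  refine ⟨?_, fun w => (hcard w).trans (hcount w), ?_⟩
  · by_contra hspan
    obtain ⟨f, hf, hle⟩ := Submodule.exists_le_ker_of_lt_top _ (lt_top_iff_ne_top.2 hspan)
    exact hf (hzero f fun i => hle (Submodule.subset_span ⟨i, rfl⟩))
  · refine IsLeast.csInf_eq ⟨?_, ?_⟩
    · have hpos : 0 < {f : Dual F (Fin k → F) |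
          f ∉ S1.dualAnnihilator ∧ f ∉ S2.dualAnnihilator}.ncard := by
        have h := ncard_compl_union_dualAnnihilator hdisj
        rw [hF, hk, h1, h2] at h
        have hset : {f : Dual F (Fin k → F) |
            f ∉ S1.dualAnnihilator ∧ f ∉ S2.dualAnnihilator} =
              ((S1.dualAnnihilator : Set (Dual F (Fin k → F))) ∪ S2.dualAnnihilator)ᶜ := by
          ext f
          simp
        rw [hset, h]
        have e1 := Nat.one_lt_pow (Nat.one_le_iff_ne_zero.1 hu1) hq₂
        have e2 := Nat.one_lt_pow (Nat.one_le_iff_ne_zero.1 hu2) hq₂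
        exact Nat.mul_pos (Nat.mul_pos (by positivity) (by omega)) (by omega)
      obtain ⟨f, hf₁, hf₂⟩ := Set.nonempty_of_ncard_ne_zero hpos.ne'
      have hf : f ≠ 0 := fun h => hf₁ (h ▸ zero_mem _)
      refine ⟨fun i => f (v i), (hcode _).2 ⟨f, rfl⟩,
        fun h => hf (hzero f fun i => congrFun h i), ?_⟩
      rw [(hammingNorm_dual_eq hv hdisj hran hf).2.2.2 hf₁ hf₂, hF, hk, h1, h2]
    · rintro w ⟨c, hc, hc₀, rfl⟩
      obtain ⟨f, rfl⟩ := (hcode c).1 hc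
      have hf : f ≠ 0 := by
        rintro rfl
        exact hc₀ rfl
      have h := hammingNorm_dual_eq hv hdisj hran hf
      simp only [hF, hk, h1, h2] at h
      by_cases m₁ : f ∈ S1.dualAnnihilator <;> by_cases m₂ : f ∈ S2.dualAnnihilator
      · rw [h.1 m₁ m₂]
        exact Nat.mul_le_mul_left _ (by omega)
      · rw [h.2.1 m₁ m₂]
        exact Nat.mul_le_mul_left _ (by omega)
      · rw [h.2.2.1 m₁ m₂]
        exact Nat.mul_le_mul_left _ (by omega)
      · rw [h.2.2.2 m₁ m₂]
end
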